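/- Every (possibly infinite) family (G_i)_{i∈I} of E-graphs over the same signature admits a least upper bound with respect to ⊑, and it is given by CC(A), where A is the tree automaton formed by the disjoint union of the states and of the transitions of all the G_i. -/

import Mathlib

set_option autoImplicit false

/-! ## Terms over a signature -/

inductive Tm (F : Type) (ar : F → ℕ) (V : Type) : Type where
  | var : V → Tm F ar V
  | node : (f : F) → (Fin (ar f) → Tm F ar V) → Tm F ar V

namespace Tm

variable {F : Type} {ar : F → ℕ} {V W : Type}

/-- Apply a renaming of variables/states. -/
def map (σ : V → W) : Tm F ar V → Tm F ar W
  | .var v => .var (σ v)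
  | .node f ts => .node f fun i => (ts i).map σ

/-- Apply a substitution. -/
def subst (σ : V → Tm F ar W) : Tm F ar V → Tm F ar W
  | .var v => σ v
  | .node f ts => .node f fun i => (ts i).subst σ

/-- The set of variables occurring in a pattern. -/
def vars : Tm F ar V → Set V
  | .var v => {v}
  | .node _ ts => ⋃ i, (ts i).vars

end Tm

/-- Ground terms: terms with no variables. -/
abbrev GTm (F : Type) (ar : F → ℕ) : Type := Tm F ar Empty

/-- A ground term viewed as a term over `Σ ∪ V`. -/
def GTm.embed {F : Type} {ar : F → ℕ} {V : Type} (t : GTm F ar) : Tm F ar V :=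
  Tm.map (fun e => e.elim) t

/-- The (reflexive) subterm relation. -/
inductive Subterm {F : Type} {ar : F → ℕ} {V : Type} : Tm F ar V → Tm F ar V → Prop where
  | refl (t : Tm F ar V) : Subterm t t
  | node {u : Tm F ar V} {f : F} {ts : Fin (ar f) → Tm F ar V} (i : Fin (ar f)) :
      Subterm u (ts i) → Subterm u (.node f ts)

theorem Subterm.trans' {F : Type} {ar : F → ℕ} {V : Type} {a b c : Tm F ar V}
    (h1 : Subterm a b) (h2 : Subterm b c) : Subterm a c := by
  induction h2 with
  | refl => exact h1
  | node i _ ih => exact Subterm.node i ih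

theorem Subterm.child {F : Type} {ar : F → ℕ} {V : Type} {f : F}
    {ts : Fin (ar f) → Tm F ar V} {c : Tm F ar V} (i : Fin (ar f))
    (h : Subterm (.node f ts) c) : Subterm (ts i) c :=
  Subterm.trans' (Subterm.node i (Subterm.refl _)) h

/-! ## Tree automata and E-graphs -/

/-- A (bottom-up, possibly infinite) tree automaton: a set of states together with
transitions `f(q₁,…,qₖ) → q`. -/
structure Automaton (F : Type) (ar : F → ℕ) : Type 1 where
  Q : Type
  trans : (f : F) → Set ((Fin (ar f) → Q) × Q)

/-- `Accepts A t q` formalizes `t →*_A q`: the term `t ∈ T(Σ ∪ Q)` rewrites to the state `q`. -/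
inductive Accepts {F : Type} {ar : F → ℕ} (A : Automaton F ar) : Tm F ar A.Q → A.Q → Prop where
  | var (q : A.Q) : Accepts A (.var q) q
  | node {f : F} {ts : Fin (ar f) → Tm F ar A.Q} {qs : Fin (ar f) → A.Q} {q : A.Q} :
      (∀ i, Accepts A (ts i) (qs i)) → (qs, q) ∈ A.trans f → Accepts A (.node f ts) q

/-- A ground term `t ∈ T(Σ)` is accepted by the state `q`, i.e. `t →*_A q`. -/
def Automaton.AcceptsG {F : Type} {ar : F → ℕ} (A : Automaton F ar) (t : GTm F ar) (q : A.Q) : Prop :=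
  Accepts A (GTm.embed t) q

/-- Deterministic: every ground term is accepted by at most one state. -/
def Automaton.Deterministic {F : Type} {ar : F → ℕ} (A : Automaton F ar) : Prop :=
  ∀ (t : GTm F ar) (q1 q2 : A.Q), A.AcceptsG t q1 → A.AcceptsG t q2 → q1 = q2

/-- Reachable: every state accepts some ground term. -/
def Automaton.ReachableA {F : Type} {ar : F → ℕ} (A : Automaton F ar) : Prop :=
  ∀ q : A.Q, ∃ t : GTm F ar, A.AcceptsG t q

/-- An E-graph is a deterministic and reachable tree automaton. -/
structure EGraph (F : Type) (ar : F → ℕ) extends Automaton F ar where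
  det : toAutomaton.Deterministic
  reach : toAutomaton.ReachableA

/-- A homomorphism of tree automata: maps states to states, preserving all transitions. -/
structure AHom {F : Type} {ar : F → ℕ} (A B : Automaton F ar) : Type where
  toFun : A.Q → B.Q
  map_trans : ∀ (f : F) (qs : Fin (ar f) → A.Q) (q : A.Q),
    (qs, q) ∈ A.trans f → (fun i => toFun (qs i), toFun q) ∈ B.trans f

/-- `A ⊑ B` : there exists a homomorphism from `A` to `B`. -/
def ALe {F : Type} {ar : F → ℕ} (A B : Automaton F ar) : Prop := Nonempty (AHom A B)

def EGraph.Le {F : Type} {ar : F → ℕ} (G H : EGraph F ar) : Prop :=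
  ALe G.toAutomaton H.toAutomaton

/-- Isomorphism of E-graphs: mutually inverse homomorphisms. -/
def EGraph.Iso {F : Type} {ar : F → ℕ} (G H : EGraph F ar) : Prop :=
  ∃ (h : AHom G.toAutomaton H.toAutomaton) (h' : AHom H.toAutomaton G.toAutomaton),
    (∀ q, h'.toFun (h.toFun q) = q) ∧ (∀ q, h.toFun (h'.toFun q) = q)

/-- The partial congruence relation `≈_G` induced by an E-graph:
two ground terms are related iff some state accepts both. -/
def EGraph.eqv {F : Type} {ar : F → ℕ} (G : EGraph F ar) (t1 t2 : GTm F ar) : Prop :=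
  ∃ q : G.Q, G.toAutomaton.AcceptsG t1 q ∧ G.toAutomaton.AcceptsG t2 q

/-- A finite E-graph: finitely many states and transitions. -/
def EGraph.IsFinite {F : Type} {ar : F → ℕ} (G : EGraph F ar) : Prop :=
  Finite G.Q ∧ ∀ f : F, (G.trans f).Finite

/-! ## Partial congruence relations -/

/-- A partial congruence relation (PCR) on ground terms: a symmetric, transitive,
congruent and reachable binary relation. -/
structure IsPCR {F : Type} {ar : F → ℕ} (E : GTm F ar → GTm F ar → Prop) : Prop where
  symm : ∀ {t1 t2 : GTm F ar}, E t1 t2 → E t2 t1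
  trans : ∀ {t1 t2 t3 : GTm F ar}, E t1 t2 → E t2 t3 → E t1 t3
  congruent : ∀ (f : F) (s t : Fin (ar f) → GTm F ar),
    (∀ i, E (s i) (t i)) → E (.node f s) (.node f s) → E (.node f s) (.node f t)
  reachable : ∀ (f : F) (s : Fin (ar f) → GTm F ar),
    E (.node f s) (.node f s) → ∀ i, E (s i) (s i)

/-- The join of two PCRs: the smallest PCR containing both. -/
def joinPCR {F : Type} {ar : F → ℕ} (E1 E2 : GTm F ar → GTm F ar → Prop)
    (a b : GTm F ar) : Prop :=
  ∀ E : GTm F ar → GTm F ar → Prop, IsPCR E →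
    (∀ x y, E1 x y → E x y) → (∀ x y, E2 x y → E x y) → E a b

/-! ## Term rewriting systems -/

/-- A term rewriting system: a finite set of rules `lhs → rhs` between patterns
(terms with variables drawn from `ℕ`), with `Var(rhs) ⊆ Var(lhs)`. -/
structure TRS (F : Type) (ar : F → ℕ) where
  rules : Set (Tm F ar ℕ × Tm F ar ℕ)
  finite : rules.Finite
  var_cond : ∀ r ∈ rules, Tm.vars r.2 ⊆ Tm.vars r.1

/-- The ground rewrite relation `→_R` determined by a TRS. -/
inductive RWStep {F : Type} {ar : F → ℕ} (R : TRS F ar) : GTm F ar → GTm F ar → Prop where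
  | rule {l r : Tm F ar ℕ} (h : (l, r) ∈ R.rules) (σ : ℕ → GTm F ar) :
      RWStep R (l.subst σ) (r.subst σ)
  | congr {f : F} {ts : Fin (ar f) → GTm F ar} {i : Fin (ar f)} {u : GTm F ar} :
      RWStep R (ts i) u → RWStep R (.node f ts) (.node f (Function.update ts i u))

/-- `≈_R` : the reflexive-symmetric-transitive closure of `→_R`. -/
def TRSEqv {F : Type} {ar : F → ℕ} (R : TRS F ar) : GTm F ar → GTm F ar → Prop :=
  Relation.ReflTransGen fun a b => RWStep R a b ∨ RWStep R b a

/-! ## E-matching, insertion and congruence closure -/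

/-- An e-match of a rule in an E-graph: a substitution `σ` into E-classes and a root
E-class `c` with `lhs[σ] →*_G c`. -/
structure EMatch {F : Type} {ar : F → ℕ} (R : TRS F ar) (G : EGraph F ar) : Type where
  lhs : Tm F ar ℕ
  rhs : Tm F ar ℕ
  mem : (lhs, rhs) ∈ R.rules
  sub : ℕ → G.Q
  root : G.Q
  acc : Accepts G.toAutomaton (Tm.map sub lhs) root

/-- Fresh states of the flattenings added by the match/apply operator: one state per
(match, subterm of the instantiated right-hand side). -/
def MExtra {F : Type} {ar : F → ℕ} (R : TRS F ar) (G : EGraph F ar) : Type :=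
  { p : EMatch R G × Tm F ar G.Q // Subterm p.2 (Tm.map p.1.sub p.1.rhs) }

open Classical in
/-- The state of the flattening `FL(rhs[σ] →* c)` associated to a subterm `u` of `rhs[σ]`:
states at the leaves are kept, the root is mapped to `c = root`, and all other subterms
get a fresh state. -/
noncomputable def stateOf {F : Type} {ar : F → ℕ} (R : TRS F ar) (G : EGraph F ar)
    (m : EMatch R G) :
    (u : Tm F ar G.Q) → Subterm u (Tm.map m.sub m.rhs) → G.Q ⊕ MExtra R G
  | .var q, _ => Sum.inl q
  | .node f ts, h =>
      if Tm.node f ts = Tm.map m.sub m.rhs then Sum.inl m.root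
      else Sum.inr ⟨(m, Tm.node f ts), h⟩

/-- The match/apply operator `T_R`: the (possibly non-deterministic) tree automaton
obtained from `G` by inserting the flattening `FL(rhs[σ] →* c)` for every e-match. -/
noncomputable def TRaut {F : Type} {ar : F → ℕ} (R : TRS F ar) (G : EGraph F ar) :
    Automaton F ar where
  Q := G.Q ⊕ MExtra R G
  trans f := { p |
    (∃ (qs : Fin (ar f) → G.Q) (q : G.Q), (qs, q) ∈ G.trans f ∧
      p = (fun i => Sum.inl (qs i), Sum.inl q)) ∨
    (∃ (m : EMatch R G) (ts : Fin (ar f) → Tm F ar G.Q)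
        (h : Subterm (.node f ts) (Tm.map m.sub m.rhs)),
      p = (fun i => stateOf R G m (ts i) (Subterm.child i h),
           stateOf R G m (.node f ts) h)) }

/-- `G` is the congruence closure (rebuilding) of the automaton `A`: the ⊑-least E-graph
above `A`. -/
def IsCC {F : Type} {ar : F → ℕ} (A : Automaton F ar) (G : EGraph F ar) : Prop :=
  ALe A G.toAutomaton ∧ ∀ H : EGraph F ar, ALe A H.toAutomaton → EGraph.Le G H

/-- `H` is (up to isomorphism) the result of the immediate consequence operator
`ICO_R = CC ∘ T_R` applied to `G`. -/
def IsICO {F : Type} {ar : F → ℕ} (R : TRS F ar) (G H : EGraph F ar) : Prop :=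
  IsCC (TRaut R G) H

/-- `S` is the sequence of iterates `S i = ICO_R^(i)(G)`. -/
def IterSeq {F : Type} {ar : F → ℕ} (R : TRS F ar) (G : EGraph F ar)
    (S : ℕ → EGraph F ar) : Prop :=
  S 0 = G ∧ ∀ i, IsICO R (S i) (S (i + 1))

/-- `H` is a least upper bound of the sequence `S` of E-graphs. -/
def IsLUBseq {F : Type} {ar : F → ℕ} (S : ℕ → EGraph F ar) (H : EGraph F ar) : Prop :=
  (∀ i, (S i).Le H) ∧ ∀ H' : EGraph F ar, (∀ i, (S i).Le H') → H.Le H'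

/-- `H` is a least upper bound of the family `Gs` of E-graphs. -/
def IsLUBfam {F : Type} {ar : F → ℕ} {I : Type} (Gs : I → EGraph F ar)
    (H : EGraph F ar) : Prop :=
  (∀ i, (Gs i).Le H) ∧ ∀ H' : EGraph F ar, (∀ i, (Gs i).Le H') → H.Le H'

/-- `H = EqSat(R, G) = ⊔_{i ≥ 0} ICO_R^(i)(G)`. -/
def IsEqSat {F : Type} {ar : F → ℕ} (R : TRS F ar) (G H : EGraph F ar) : Prop :=
  ∃ S : ℕ → EGraph F ar, IterSeq R G S ∧ IsLUBseq S H

/-- `H` is a model of the TRS `R`. -/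
def ModelTRS {F : Type} {ar : F → ℕ} (R : TRS F ar) (H : EGraph F ar) : Prop :=
  ∀ r ∈ R.rules, ∀ (σ : ℕ → H.Q) (c : H.Q),
    Accepts H.toAutomaton (Tm.map σ r.1) c → Accepts H.toAutomaton (Tm.map σ r.2) c

/-- `H` is a model of the pair `(R, G)`. -/
def IsModelOf {F : Type} {ar : F → ℕ} (R : TRS F ar) (G H : EGraph F ar) : Prop :=
  G.Le H ∧ ModelTRS R H

/-- `H` is a universal model of the pair `(R, G)`. -/
def IsUniversalModel {F : Type} {ar : F → ℕ} (R : TRS F ar) (G H : EGraph F ar) : Prop :=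
  IsModelOf R G H ∧ ∀ H' : EGraph F ar, IsModelOf R G H' → H.Le H'

/-- `G` is (up to isomorphism) the flattening `FL(t →* c)` of a ground term `t`:
the ⊑-least E-graph representing `t`. -/
def IsTermEG {F : Type} {ar : F → ℕ} (t : GTm F ar) (G : EGraph F ar) : Prop :=
  (∃ c, G.toAutomaton.AcceptsG t c) ∧
  ∀ H : EGraph F ar, (∃ c, H.toAutomaton.AcceptsG t c) → G.Le H

/-- Equality saturation terminates on `(R, G)`: the sequence of iterates
`ICO_R^(i)(G)` is eventually constant up to isomorphism. -/
def EqSatTerminates {F : Type} {ar : F → ℕ} (R : TRS F ar) (G : EGraph F ar) : Prop :=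
  ∃ S : ℕ → EGraph F ar, IterSeq R G S ∧ ∃ n, ∀ m, n ≤ m → (S m).Iso (S n)

/-- The disjoint union of a family of E-graphs, as a tree automaton: the disjoint union
of the states and of the transitions. -/
def disjUnion {F : Type} {ar : F → ℕ} {I : Type} (Gs : I → EGraph F ar) :
    Automaton F ar where
  Q := Σ i : I, (Gs i).Q
  trans f := { p | ∃ (i : I) (qs : Fin (ar f) → (Gs i).Q) (q : (Gs i).Q),
    (qs, q) ∈ (Gs i).trans f ∧ p = (fun j => ⟨i, qs j⟩, ⟨i, q⟩) }

section CongruenceClosure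

variable {F : Type} {ar : F → ℕ}

namespace Automaton

theorem acceptsG_node_iff {A : Automaton F ar} {f : F} {ts : Fin (ar f) → GTm F ar} {q : A.Q} :
    A.AcceptsG (.node f ts) q ↔
      ∃ qs : Fin (ar f) → A.Q, (∀ i, A.AcceptsG (ts i) (qs i)) ∧ (qs, q) ∈ A.trans f := by
  constructor
  · intro h
    cases h with
    | node hts hq => exact ⟨_, hts, hq⟩
  · rintro ⟨qs, hts, hq⟩
    exact Accepts.node hts hq

theorem AcceptsG.map {A B : Automaton F ar} (h : AHom A B) {t : GTm F ar} {q : A.Q}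
    (ht : A.AcceptsG t q) : B.AcceptsG t (h.toFun q) := by
  induction t generalizing q with
  | var v => exact v.elim
  | node f ts ih =>
    obtain ⟨qs, hts, hq⟩ := acceptsG_node_iff.1 ht
    exact acceptsG_node_iff.2 ⟨_, fun i => ih i (hts i), h.map_trans f qs q hq⟩

/-- An automaton whose transitions are functional is deterministic. -/
theorem deterministic_of_trans {A : Automaton F ar}
    (hA : ∀ (f : F) (qs : Fin (ar f) → A.Q) (q q' : A.Q),
      (qs, q) ∈ A.trans f → (qs, q') ∈ A.trans f → q = q') : A.Deterministic := by
  intro t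
  induction t with
  | var v => exact v.elim
  | node f ts ih =>
    intro q q' h h'
    obtain ⟨qs, hts, hq⟩ := acceptsG_node_iff.1 h
    obtain ⟨qs', hts', hq'⟩ := acceptsG_node_iff.1 h'
    obtain rfl : qs = qs' := funext fun i => ih i _ _ (hts i) (hts' i)
    exact hA f qs q q' hq hq'

end Automaton

/-- The transitions of an E-graph are functional. -/
theorem EGraph.trans_unique (G : EGraph F ar) {f : F} {qs : Fin (ar f) → G.Q} {q q' : G.Q}
    (h : (qs, q) ∈ G.trans f) (h' : (qs, q') ∈ G.trans f) : q = q' := by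
  choose ts hts using fun i => G.reach (qs i)
  exact G.det (.node f ts) q q' (Automaton.acceptsG_node_iff.2 ⟨qs, hts, h⟩)
    (Automaton.acceptsG_node_iff.2 ⟨qs, hts, h'⟩)

/-- The composition of two homomorphisms. -/
def AHom.comp {A B C : Automaton F ar} (g : AHom B C) (h : AHom A B) : AHom A C where
  toFun q := g.toFun (h.toFun q)
  map_trans f qs q hq := g.map_trans f _ _ (h.map_trans f qs q hq)

theorem ALe.trans {A B C : Automaton F ar} : ALe A B → ALe B C → ALe A C :=
  fun ⟨h⟩ ⟨g⟩ => ⟨g.comp h⟩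

namespace Automaton

/-- Two states are identified when every homomorphism to an E-graph identifies them. -/
def ccSetoid (A : Automaton F ar) : Setoid A.Q where
  r q q' := ∀ (H : EGraph F ar) (h : AHom A H.toAutomaton), h.toFun q = h.toFun q'
  iseqv :=
    { refl := fun _ _ _ => rfl
      symm := fun hq H h => (hq H h).symm
      trans := fun hq hq' H h => (hq H h).trans (hq' H h) }

/-- The quotient of an automaton by `ccSetoid`. -/
def ccQuotient (A : Automaton F ar) : Automaton F ar where
  Q := Quotient A.ccSetoid
  trans f := { p | ∃ (qs : Fin (ar f) → A.Q) (q : A.Q), (qs, q) ∈ A.trans f ∧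
    p = (fun i => Quotient.mk _ (qs i), Quotient.mk _ q) }

/-- The projection of an automaton to its quotient. -/
def ccProj (A : Automaton F ar) : AHom A A.ccQuotient where
  toFun := Quotient.mk _
  map_trans _ qs q hq := ⟨qs, q, hq, rfl⟩

theorem ccQuotient_deterministic (A : Automaton F ar) : A.ccQuotient.Deterministic := by
  refine deterministic_of_trans ?_
  rintro f _ _ q' ⟨qs, q, hq, heq⟩ ⟨qs', r, hr, heq'⟩
  obtain ⟨rfl, rfl⟩ := Prod.mk.inj heq
  obtain ⟨hqs, rfl⟩ := Prod.mk.inj heq'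
  refine Quotient.sound fun H h => H.trans_unique (h.map_trans f qs q hq) ?_
  have hrel : (fun i => h.toFun (qs i)) = fun i => h.toFun (qs' i) :=
    funext fun i => Quotient.exact (congrFun hqs i) H h
  rw [hrel]
  exact h.map_trans f qs' r hr

theorem ccQuotient_reachable {A : Automaton F ar} (hA : A.ReachableA) :
    A.ccQuotient.ReachableA := by
  intro q
  induction q using Quotient.inductionOn with
  | h q =>
    obtain ⟨t, ht⟩ := hA q
    exact ⟨t, ht.map A.ccProj⟩

/-- A homomorphism to an E-graph factors through the quotient. -/
def ccLift (A : Automaton F ar) (H : EGraph F ar) (h : AHom A H.toAutomaton) :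
    AHom A.ccQuotient H.toAutomaton where
  toFun := Quotient.lift h.toFun fun _ _ hq => hq H h
  map_trans f _ _ := by
    rintro ⟨qs, q, hq, heq⟩
    obtain ⟨rfl, rfl⟩ := Prod.mk.inj heq
    exact h.map_trans f qs q hq

end Automaton

/-- Every reachable automaton has a congruence closure. -/
theorem exists_isCC {A : Automaton F ar} (hA : A.ReachableA) : ∃ G : EGraph F ar, IsCC A G :=
  ⟨{ toAutomaton := A.ccQuotient
     det := A.ccQuotient_deterministic
     reach := Automaton.ccQuotient_reachable hA },
    ⟨A.ccProj⟩, fun H ⟨h⟩ => ⟨A.ccLift H h⟩⟩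

/-- The inclusion of a member of a family into the disjoint union. -/
def disjUnionIncl {I : Type} (Gs : I → EGraph F ar) (i : I) :
    AHom (Gs i).toAutomaton (disjUnion Gs) where
  toFun q := ⟨i, q⟩
  map_trans _ qs q hq := ⟨i, qs, q, hq, rfl⟩

theorem disjUnion_reachable {I : Type} (Gs : I → EGraph F ar) : (disjUnion Gs).ReachableA := by
  rintro ⟨i, q⟩
  obtain ⟨t, ht⟩ := (Gs i).reach q
  exact ⟨t, ht.map (disjUnionIncl Gs i)⟩

theorem disjUnion_le {I : Type} {Gs : I → EGraph F ar} {B : Automaton F ar}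
    (hB : ∀ i, ALe (Gs i).toAutomaton B) : ALe (disjUnion Gs) B := by
  have h (i : I) : AHom (Gs i).toAutomaton B := Classical.choice (hB i)
  refine ⟨⟨fun p => (h p.1).toFun p.2, ?_⟩⟩
  rintro f _ _ ⟨i, qs, q, hq, heq⟩
  obtain ⟨rfl, rfl⟩ := Prod.mk.inj heq
  exact (h i).map_trans f qs q hq

end CongruenceClosure

/-- Every (possibly infinite) family of E-graphs admits a least upper bound w.r.t. `⊑`,
and it is given by `CC(A)` where `A` is the disjoint union of the family. -/
theorem egraph_lub_exists {F : Type} {ar : F → ℕ} [Finite F] {I : Type}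
    (Gs : I → EGraph F ar) :
    (∃ G : EGraph F ar, IsCC (disjUnion Gs) G) ∧
    (∀ G : EGraph F ar, IsCC (disjUnion Gs) G → IsLUBfam Gs G) := by
  refine ⟨exists_isCC (disjUnion_reachable Gs), fun G hG => ⟨fun i => ?_, fun H hH => ?_⟩⟩
  · exact ALe.trans ⟨disjUnionIncl Gs i⟩ hG.1
  · exact hG.2 H (disjUnion_le hH)
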